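/- Let F be a field, 0 ≤ m ≤ r, and suppose that for every m-dimensional subspace Δ of F^r a matrix G_Δ ∈ GL_r(F) is fixed whose first m rows span Δ. Then the map (Δ, U) ↦ ᵗG_Δ · diag(U, 0_{r−m}) · G_Δ is a bijection from the set of pairs (Δ, U), with Δ an m-dimensional subspace of F^r and U an invertible symmetric m×m matrix over F, onto the set of symmetric r×r matrices over F of rank m. -/

import Mathlib

open Matrix

/-- `diag(U, 0_{r-m})`: the `r × r` matrix whose upper-left `m × m` block is `U` and whose
remaining entries are `0`. -/
def Matrix.diagPad {F : Type*} [Zero F] {m r : ℕ} (U : Matrix (Fin m) (Fin m) F) :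
    Matrix (Fin r) (Fin r) F :=
  Matrix.of fun i j =>
    if h : i.val < m ∧ j.val < m then U ⟨i.val, h.1⟩ ⟨j.val, h.2⟩ else 0

namespace Matrix

/-- Padding `U` with zeros is the congruence transform of `U` by the first `m` rows of the
identity. -/
theorem diagPad_eq_transpose_mul_mul {F : Type*} [CommRing F] {r m : ℕ} (hm : m ≤ r)
    (U : Matrix (Fin m) (Fin m) F) :
    (diagPad U : Matrix (Fin r) (Fin r) F) =
      ((1 : Matrix (Fin r) (Fin r) F).submatrix (Fin.castLE hm) id)ᵀ * U *
        (1 : Matrix (Fin r) (Fin r) F).submatrix (Fin.castLE hm) id := by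
  ext i j
  simp only [diagPad, of_apply, mul_apply, transpose_apply, submatrix_apply, id, one_apply,
    ite_mul, one_mul, zero_mul, mul_ite, mul_one, mul_zero]
  have key (k : Fin r) (f : Fin m → F) :
      (∑ a, if Fin.castLE hm a = k then f a else 0) = if h : k.val < m then f ⟨k, h⟩ else 0 := by
    split_ifs with h
    · rw [Finset.sum_eq_single ⟨k, h⟩]
      · rw [if_pos (by ext; rfl)]
      · exact fun b _ hb => if_neg fun e => hb (by ext; simp [← e])
      · simp
    · refine Finset.sum_eq_zero fun a _ => if_neg fun e => h ?_
      simp [← e]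
  simp only [key]
  by_cases hi : i.val < m <;> by_cases hj : j.val < m <;> simp [hi, hj]

theorem transpose_mul_diagPad_mul {F : Type*} [CommRing F] {r m : ℕ} (hm : m ≤ r)
    (G : Matrix (Fin r) (Fin r) F) (U : Matrix (Fin m) (Fin m) F) :
    Gᵀ * diagPad U * G =
      (G.submatrix (Fin.castLE hm) id)ᵀ * U * G.submatrix (Fin.castLE hm) id := by
  have h : G.submatrix (Fin.castLE hm) id =
      (1 : Matrix (Fin r) (Fin r) F).submatrix (Fin.castLE hm) id * G := by
    ext i j
    simp [mul_apply, one_apply]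
  rw [h, diagPad_eq_transpose_mul_mul hm, transpose_mul]
  simp only [Matrix.mul_assoc]

/-- Distinct rows of an invertible matrix form a matrix with a right inverse. -/
theorem exists_submatrix_mul_eq_one {F m n : Type*} [CommRing F] [Fintype n] [DecidableEq n]
    [DecidableEq m] {G : Matrix n n F} (hG : IsUnit G) {e : m → n} (he : Function.Injective e) :
    ∃ C : Matrix n m F, G.submatrix e id * C = 1 := by
  obtain ⟨H, hH⟩ := hG.exists_right_inv
  refine ⟨H.submatrix id e, ?_⟩
  rw [← submatrix_mul _ _ _ _ _ Function.bijective_id, hH, submatrix_one e he]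

/-- Left multiplication by a matrix with a left inverse preserves the row space. -/
theorem span_range_row_mul_of_left_inv {F k m n : Type*} [CommRing F] [Fintype k] [Fintype m]
    [DecidableEq m] {A : Matrix k m F} {D : Matrix m k F} (hD : D * A = 1) (B : Matrix m n F) :
    Submodule.span F (Set.range (A * B).row) = Submodule.span F (Set.range B.row) := by
  rw [← range_vecMulLinear, ← range_vecMulLinear]
  apply le_antisymm
  · rintro _ ⟨x, rfl⟩
    exact ⟨x ᵥ* A, by simp [vecMul_vecMul]⟩
  · rintro _ ⟨x, rfl⟩
    refine ⟨x ᵥ* D, ?_⟩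
    simp [vecMul_vecMul, ← Matrix.mul_assoc, hD]

theorem span_range_row_transpose_mul_mul {F m n : Type*} [CommRing F] [Fintype m] [Fintype n]
    [DecidableEq m] {B : Matrix m n F} {C : Matrix n m F} (hC : B * C = 1)
    {U : Matrix m m F} (hU : IsUnit U) :
    Submodule.span F (Set.range (Bᵀ * U * B).row) = Submodule.span F (Set.range B.row) := by
  obtain ⟨V, hV⟩ := hU.exists_left_inv
  have hCB : Cᵀ * Bᵀ = 1 := by rw [← transpose_mul, hC, transpose_one]
  refine span_range_row_mul_of_left_inv (D := V * Cᵀ) ?_ B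
  rw [Matrix.mul_assoc, ← Matrix.mul_assoc Cᵀ, hCB, Matrix.one_mul, hV]

theorem transpose_mul_congr_mul {F m n : Type*} [CommRing F] [Fintype m] [Fintype n]
    [DecidableEq m] {B : Matrix m n F} {C : Matrix n m F} (hC : B * C = 1) (U : Matrix m m F) :
    Cᵀ * (Bᵀ * U * B) * C = U := by
  have hCB : Cᵀ * Bᵀ = 1 := by rw [← transpose_mul, hC, transpose_one]
  rw [Matrix.mul_assoc, Matrix.mul_assoc _ B, hC, Matrix.mul_one, ← Matrix.mul_assoc, hCB,
    Matrix.one_mul]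

/-- A matrix whose rows lie in the row space of `B` is a left multiple of `B`. -/
theorem exists_eq_mul_of_span_range_row_le {F k m n : Type*} [CommRing F] [Fintype m]
    {B : Matrix m n F} {W : Matrix k n F}
    (h : Submodule.span F (Set.range W.row) ≤ Submodule.span F (Set.range B.row)) :
    ∃ X : Matrix k m F, W = X * B := by
  rw [← range_vecMulLinear B] at h
  choose X hX using fun i => h (Submodule.subset_span (Set.mem_range_self i))
  refine ⟨of X, ?_⟩
  ext i j
  rw [mul_apply_eq_vecMul]
  exact (congrFun (hX i) j).symm

/-- A symmetric matrix whose rows lie in the row space of `B` is congruent through `B` to its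
compression by any right inverse of `B`. -/
theorem IsSymm.transpose_mul_compress_mul {F m n : Type*} [CommRing F] [Fintype m] [Fintype n]
    [DecidableEq m] {B : Matrix m n F} {C : Matrix n m F} (hC : B * C = 1)
    {W : Matrix n n F} (hW : W.IsSymm)
    (h : Submodule.span F (Set.range W.row) ≤ Submodule.span F (Set.range B.row)) :
    Bᵀ * (Cᵀ * W * C) * B = W := by
  obtain ⟨X, hX⟩ := exists_eq_mul_of_span_range_row_le h
  have hWCB : W * C * B = W := by
    rw [hX, Matrix.mul_assoc X, hC, Matrix.mul_one]
  have hBCW : Bᵀ * (Cᵀ * W) = W := by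
    simpa [transpose_mul, hW.eq] using congrArg (fun M : Matrix n n F => Mᵀ) hWCB
  rw [← Matrix.mul_assoc, hBCW, hWCB]

theorem isUnit_of_rank_eq_card {F n : Type*} [Field F] [Fintype n] [DecidableEq n]
    {U : Matrix n n F} (hU : U.rank = Fintype.card n) : IsUnit U := by
  rw [← linearIndependent_rows_iff_isUnit, linearIndependent_iff_card_eq_finrank_span,
    Set.finrank, ← rank_eq_finrank_span_row, hU]

end Matrix

/-- Let `F` be a field, `0 ≤ m ≤ r`, and suppose that for every `m`-dimensional subspace `Δ` of
`F^r` (row vectors) a matrix `G_Δ ∈ GL_r(F)` is fixed whose first `m` rows span `Δ`.  Then the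
map `(Δ, U) ↦ ᵗG_Δ ⬝ diag(U, 0_{r-m}) ⬝ G_Δ` is a bijection from the set of pairs `(Δ, U)`, with
`Δ` an `m`-dimensional subspace of `F^r` and `U` an invertible symmetric `m × m` matrix over `F`,
onto the set of symmetric `r × r` matrices over `F` of rank `m`. -/
theorem bijOn_subspace_symm_unit_pairs_rank_m
    {F : Type*} [Field F] {r m : ℕ} (hm : m ≤ r)
    (G : Submodule F (Fin r → F) → Matrix (Fin r) (Fin r) F)
    (hGunit : ∀ Δ : Submodule F (Fin r → F), Module.finrank F ↥Δ = m → IsUnit (G Δ))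
    (hGspan : ∀ Δ : Submodule F (Fin r → F), Module.finrank F ↥Δ = m →
      Submodule.span F (Set.range fun i : Fin m => G Δ (Fin.castLE hm i)) = Δ) :
    Set.BijOn
      (fun p : Submodule F (Fin r → F) × Matrix (Fin m) (Fin m) F =>
        (G p.1)ᵀ * Matrix.diagPad p.2 * G p.1)
      {p | Module.finrank F ↥p.1 = m ∧ p.2.IsSymm ∧ IsUnit p.2}
      {W | W.IsSymm ∧ W.rank = m} := by
  choose! C hC using fun (Δ : Submodule F (Fin r → F)) (h : Module.finrank F ↥Δ = m) =>
    Matrix.exists_submatrix_mul_eq_one (hGunit Δ h) (Fin.castLE_injective hm)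
  simp only [Matrix.transpose_mul_diagPad_mul hm]
  set B : Submodule F (Fin r → F) → Matrix (Fin m) (Fin r) F :=
    fun Δ => (G Δ).submatrix (Fin.castLE hm) id
  replace hC : ∀ Δ : Submodule F (Fin r → F), Module.finrank F ↥Δ = m → B Δ * C Δ = 1 := hC
  replace hGspan : ∀ Δ : Submodule F (Fin r → F), Module.finrank F ↥Δ = m →
    Submodule.span F (Set.range (B Δ).row) = Δ := hGspan
  have hrow : ∀ Δ : Submodule F (Fin r → F), Module.finrank F ↥Δ = m →
      ∀ U : Matrix (Fin m) (Fin m) F, IsUnit U →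
      Submodule.span F (Set.range ((B Δ)ᵀ * U * B Δ).row) = Δ := fun Δ hΔ U hU =>
    (Matrix.span_range_row_transpose_mul_mul (hC Δ hΔ) hU).trans (hGspan Δ hΔ)
  refine ⟨?_, ?_, ?_⟩
  · rintro ⟨Δ, U⟩ ⟨hΔ, hUs, hU⟩
    refine ⟨?_, ?_⟩
    · simp only [Matrix.IsSymm, Matrix.transpose_mul, Matrix.transpose_transpose, hUs.eq,
        Matrix.mul_assoc]
    · rw [Matrix.rank_eq_finrank_span_row]
      exact (congrArg (fun S : Submodule F (Fin r → F) => Module.finrank F ↥S)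
        (hrow Δ hΔ U hU)).trans hΔ
  · rintro ⟨Δ, U⟩ ⟨hΔ, -, hU⟩ ⟨Δ', U'⟩ ⟨hΔ', -, hU'⟩ h
    dsimp only at hΔ hU hΔ' hU' h
    obtain rfl : Δ = Δ' := by rw [← hrow Δ hΔ U hU, h, hrow Δ' hΔ' U' hU']
    rw [← Matrix.transpose_mul_congr_mul (hC Δ hΔ) U, h,
      Matrix.transpose_mul_congr_mul (hC Δ hΔ)]
  · rintro W ⟨hWs, hWr⟩
    obtain ⟨Δ, hΔW⟩ : ∃ Δ : Submodule F (Fin r → F),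
        Submodule.span F (Set.range W.row) = Δ := ⟨_, rfl⟩
    have hΔ : Module.finrank F ↥Δ = m := by
      rw [← hΔW, ← Matrix.rank_eq_finrank_span_row, hWr]
    have hW : (B Δ)ᵀ * ((C Δ)ᵀ * W * C Δ) * B Δ = W :=
      hWs.transpose_mul_compress_mul (hC Δ hΔ) (by rw [hGspan Δ hΔ, hΔW])
    refine ⟨(Δ, (C Δ)ᵀ * W * C Δ), ⟨hΔ, ?_, ?_⟩, hW⟩
    · simp only [Matrix.IsSymm, Matrix.transpose_mul, Matrix.transpose_transpose, hWs.eq,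
        Matrix.mul_assoc]
    · apply Matrix.isUnit_of_rank_eq_card
      refine le_antisymm (Matrix.rank_le_card_width _) ?_
      rw [Fintype.card_fin]
      calc m = ((B Δ)ᵀ * ((C Δ)ᵀ * W * C Δ) * B Δ).rank := by rw [hW, hWr]
        _ ≤ ((B Δ)ᵀ * ((C Δ)ᵀ * W * C Δ)).rank := Matrix.rank_mul_le_left _ _
        _ ≤ ((C Δ)ᵀ * W * C Δ).rank := Matrix.rank_mul_le_right _ _
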